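/- Let a ∈ ℝ, let 0 < β̲ ≤ β̄, 0 < η̲ ≤ η̄, ν̄ > 0, and let h : ℝ → ℝ be bounded and measurable. Then the optimal value of the relaxed worst-case tail problem equals the optimal value of ÕPT(𝒫⁺), i.e. the supremum of ν̄ E_P[H(X)] over Borel probability measures P on [0, ∞) with μ̲ ≤ E_P[X] ≤ μ̄ and σ̲ ≤ E_P[X²] ≤ σ̄. Moreover, there is a one-to-one correspondence between feasible solutions of the two problems given by f′₊(x + a) = ν̄(p(x) − 1) for x ≥ 0 and f(x) = f(a) + ∫_a^x f′₊(t) dt for x ≥ a, where p is the cumulative distribution function of the feasible measure P, and corresponding solutions have equal objective values. -/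

import Mathlib

open MeasureTheory Set Filter Topology

/-- The right derivative of `f` at `x`: the derivative within `(x, ∞)`. -/
noncomputable def rightDeriv (f : ℝ → ℝ) (x : ℝ) : ℝ := derivWithin f (Set.Ioi x) x

/-- The right derivative of `f` exists at `x`. -/
def HasRightDerivAt (f : ℝ → ℝ) (x : ℝ) : Prop := ∃ d : ℝ, HasDerivWithinAt f d (Set.Ioi x) x

/-- `f` is feasible for the relaxed worst-case tail problem with parameters
`(a, β̲, β̄, η̲, η̄, ν̄)`. -/
def RFeasible (a βl βu ηl ηu ν : ℝ) (f : ℝ → ℝ) : Prop :=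
  IntegrableOn f (Set.Ioi a) ∧
  βl ≤ (∫ x in Set.Ioi a, f x) ∧ (∫ x in Set.Ioi a, f x) ≤ βu ∧
  ηl ≤ f a ∧ f a ≤ ηu ∧
  ContinuousWithinAt f (Set.Ici a) a ∧
  HasRightDerivAt f a ∧
  -ν ≤ rightDeriv f a ∧
  ConvexOn ℝ (Set.Ici a) f ∧
  (∀ x, a ≤ x → 0 ≤ f x)

/-- `H(x) = ∫₀ˣ ∫₀ᵘ h(v + a) dv du`. -/
noncomputable def Hfun (a : ℝ) (h : ℝ → ℝ) (x : ℝ) : ℝ :=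
  ∫ u in (0:ℝ)..x, (∫ v in (0:ℝ)..u, h (v + a))

/-- `P` is a Borel probability measure on `[0, ∞)` (modelled as a measure on `ℝ`
concentrated on `[0, ∞)`) with first moment in `[μ̲, μ̄]` and second moment in
`[σ̲, σ̄]`. -/
def RMomFeasible (μl μu σl σu : ℝ) (P : Measure ℝ) : Prop :=
  IsProbabilityMeasure P ∧ P (Set.Iio 0) = 0 ∧
  Integrable (fun x => x) P ∧ Integrable (fun x => x ^ 2) P ∧
  μl ≤ (∫ x, x ∂P) ∧ (∫ x, x ∂P) ≤ μu ∧
  σl ≤ (∫ x, x ^ 2 ∂P) ∧ (∫ x, x ^ 2 ∂P) ≤ σu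

lemma aux_double (k : ℝ → ℝ) (hk : Measurable k) (M : ℝ) (hM : ∀ x, |k x| ≤ M) (y : ℝ) (hy : 0 ≤ y) :
    (∫ u in (0:ℝ)..y, ∫ v in (0:ℝ)..u, k v) = ∫ t in Ioi (0:ℝ), k t * max (y - t) 0 := by
  have hR : (∫ t in Ioi (0:ℝ), k t * max (y - t) 0) = ∫ v in Ioc 0 y, k v * (y - v) := by
    have : (∫ t in Ioi (0:ℝ), k t * max (y - t) 0) = ∫ t in Ioc (0:ℝ) y, k t * max (y - t) 0 := by
      apply setIntegral_eq_of_subset_of_forall_sdiff_eq_zero measurableSet_Ioi Ioc_subset_Ioi_self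
      intro x hx
      have h1 : y < x := by
        by_contra hc
        exact hx.2 ⟨hx.1, not_lt.mp hc⟩
      rw [max_eq_right (by linarith), mul_zero]
    rw [this]
    apply setIntegral_congr_fun measurableSet_Ioc
    intro t ht
    simp only [max_eq_left (sub_nonneg.mpr ht.2)]
  rw [hR, intervalIntegral.integral_of_le hy]
  set G : ℝ → ℝ → ℝ := fun u v => (Iic u).indicator k v with hG
  have hL : (∫ u in Ioc 0 y, ∫ v in (0:ℝ)..u, k v) = ∫ u in Ioc 0 y, ∫ v in Ioc 0 y, G u v := by
    apply setIntegral_congr_fun measurableSet_Ioc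
    intro u hu
    simp only [hG]
    rw [intervalIntegral.integral_of_le hu.1.le, setIntegral_indicator measurableSet_Iic]
    congr 2
    ext v; simp only [mem_Ioc, mem_inter_iff, mem_Iic]
    constructor
    · rintro ⟨h1, h2⟩; exact ⟨⟨h1, h2.trans hu.2⟩, h2⟩
    · rintro ⟨⟨h1, _⟩, h2⟩; exact ⟨h1, h2⟩
  have hGm : Measurable (Function.uncurry G) := by
    have : Function.uncurry G = {p : ℝ × ℝ | p.2 ≤ p.1}.indicator (fun p => k p.2) := by
      ext p; simp only [Function.uncurry, hG, indicator, mem_Iic, mem_ofPred_eq]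
    rw [this]
    exact (hk.comp measurable_snd).indicator (measurableSet_le measurable_snd measurable_fst)
  rw [hL, integral_integral_swap]
  · apply setIntegral_congr_fun measurableSet_Ioc
    intro v hv
    have : ∀ u, G u v = (Ici v).indicator (fun _ => k v) u := by
      intro u; simp only [hG, indicator, mem_Iic, mem_Ici]
    simp only [this]
    rw [setIntegral_indicator measurableSet_Ici]
    have : Ioc 0 y ∩ Ici v = Icc v y := by
      ext u; simp only [mem_Ioc, mem_inter_iff, mem_Ici, mem_Icc]
      constructor
      · rintro ⟨⟨h1, h2⟩, h3⟩; exact ⟨h3, h2⟩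
      · rintro ⟨h1, h2⟩; exact ⟨⟨hv.1.trans_le h1, h2⟩, h1⟩
    rw [this]
    simp [Measure.real, hv.2, mul_comm]
  · refine Integrable.of_bound hGm.aestronglyMeasurable M (Eventually.of_forall fun p => ?_)
    simp only [Function.uncurry, hG, Real.norm_eq_abs, indicator]
    split_ifs
    · exact hM _
    · simpa using (abs_nonneg _).trans (hM 0)

lemma aux_one (y : ℝ) (hy : 0 ≤ y) : (∫ t in Ioi (0:ℝ), max (y - t) 0) = y ^ 2 / 2 := by
  have := aux_double (fun _ => 1) measurable_const 1 (by simp) y hy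
  simp only [one_mul] at this
  rw [← this]
  simp

lemma aux_one_int (y : ℝ) : IntegrableOn (fun t => max (y - t) 0) (Ioi (0:ℝ)) := by
  have hc : Continuous (fun t : ℝ => max (y - t) 0) := by fun_prop
  rcases le_total 0 y with hy | hy
  · have h1 : IntegrableOn (fun t => max (y - t) 0) (Ioc 0 y) :=
      (hc.continuousOn.integrableOn_Icc (a := 0) (b := y)).mono_set Ioc_subset_Icc_self
    refine h1.of_forall_sdiff_eq_zero measurableSet_Ioi fun x hx => ?_
    have h1 : y < x := by
      by_contra hc
      exact hx.2 ⟨hx.1, not_lt.mp hc⟩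
    exact max_eq_right (by linarith)
  · refine (integrableOn_zero).congr_fun (fun x hx => ?_) measurableSet_Ioi
    have : 0 < x := hx
    simp only
    exact (max_eq_right (by linarith)).symm

lemma pos_int {P : Measure ℝ} [IsProbabilityMeasure P] (hi : Integrable (fun x => x) P) (s : ℝ) :
    Integrable (fun y => max (y - s) 0) P :=
  (hi.sub (integrable_const s)).pos_part

lemma prod_int {P : Measure ℝ} [IsProbabilityMeasure P] (h0 : ∀ᵐ y ∂P, 0 ≤ y)
    (hi : Integrable (fun x => x) P) :
    (Integrable (fun y => y ^ 2) P ↔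
      Integrable (fun p : ℝ × ℝ => max (p.2 - p.1) 0) ((volume.restrict (Ioi 0)).prod P)) ∧
    (Integrable (fun y => y ^ 2) P ↔ IntegrableOn (fun s => ∫ y, max (y - s) 0 ∂P) (Ioi 0)) := by
  have hm : AEStronglyMeasurable (fun p : ℝ × ℝ => max (p.2 - p.1) 0)
      ((volume.restrict (Ioi 0)).prod P) := by
    have : Continuous (fun p : ℝ × ℝ => max (p.2 - p.1) 0) := by fun_prop
    exact this.aestronglyMeasurable
  have hn : ∀ a b : ℝ, ‖max (a - b) 0‖ = max (a - b) 0 := fun a b =>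
    Real.norm_of_nonneg (le_max_right _ _)
  have e1 := integrable_prod_iff hm
  have e2 := integrable_prod_iff' hm
  simp only [hn] at e1 e2
  have f1 : (∀ᵐ x ∂(volume.restrict (Ioi (0:ℝ))), Integrable (fun y => max (y - x) 0) P) :=
    Eventually.of_forall fun x => pos_int hi x
  have f2 : (∀ᵐ y ∂P, Integrable (fun x => max (y - x) 0) (volume.restrict (Ioi (0:ℝ)))) :=
    Eventually.of_forall fun y => aux_one_int y
  have f3 : Integrable (fun y => ∫ x in Ioi 0, max (y - x) 0) P ↔ Integrable (fun y => y ^ 2) P := by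
    have : (fun y => ∫ x in Ioi 0, max (y - x) 0) =ᵐ[P] fun y => (1/2) * y ^ 2 := by
      filter_upwards [h0] with y hy
      rw [aux_one y hy]; ring
    rw [integrable_congr this]
    exact integrable_const_mul_iff (by norm_num) _
  simp only [f1, f2, f3, true_and] at e1 e2
  exact ⟨e2.symm, e2.symm.trans e1⟩

lemma fub {P : Measure ℝ} [IsProbabilityMeasure P] (h0 : ∀ᵐ y ∂P, 0 ≤ y)
    (hi : Integrable (fun x => x) P) (hi2 : Integrable (fun x => x ^ 2) P)
    (k : ℝ → ℝ) (hk : Measurable k) (M : ℝ) (hM : ∀ x, |k x| ≤ M) :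
    (∫ s in Ioi (0:ℝ), k s * ∫ y, max (y - s) 0 ∂P) =
      ∫ y, (∫ u in (0:ℝ)..y, ∫ v in (0:ℝ)..u, k v) ∂P := by
  have h1 := (prod_int h0 hi).1.1 hi2
  have h2 : Integrable (fun p : ℝ × ℝ => k p.1 * max (p.2 - p.1) 0)
      ((volume.restrict (Ioi 0)).prod P) :=
    h1.bdd_mul (c := M) (hk.comp measurable_fst).aestronglyMeasurable
      (Eventually.of_forall fun p => hM _)
  simp_rw [← integral_const_mul]
  rw [integral_integral_swap (f := fun s y => k s * max (y - s) 0) h2]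
  apply integral_congr_ae
  filter_upwards [h0] with y hy
  exact (aux_double k hk M hM y hy).symm

lemma fub_one {P : Measure ℝ} [IsProbabilityMeasure P] (h0 : ∀ᵐ y ∂P, 0 ≤ y)
    (hi : Integrable (fun x => x) P) (hi2 : Integrable (fun x => x ^ 2) P) :
    (∫ s in Ioi (0:ℝ), ∫ y, max (y - s) 0 ∂P) = (∫ y, y ^ 2 ∂P) / 2 := by
  have := fub h0 hi hi2 (fun _ => 1) measurable_const 1 (by simp)
  simp only [one_mul] at this
  rw [this, ← integral_div]
  simp

lemma shift_pre (c a : ℝ) : (fun t => t + a) ⁻¹' Ioi (c + a) = Ioi c := by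
  ext t; simp

lemma shift_int (φ : ℝ → ℝ) (c a : ℝ) :
    (∫ t in Ioi c, φ (t + a)) = ∫ x in Ioi (c + a), φ x := by
  have := (measurePreserving_add_right (volume : Measure ℝ) a).setIntegral_preimage_emb
    (MeasurableEquiv.addRight a).measurableEmbedding φ (Ioi (c + a))
  rwa [shift_pre] at this

lemma shift_intOn (φ : ℝ → ℝ) (c a : ℝ) :
    IntegrableOn (fun t => φ (t + a)) (Ioi c) ↔ IntegrableOn φ (Ioi (c + a)) := by
  have := (measurePreserving_add_right (volume : Measure ℝ) a).integrableOn_comp_preimage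
    (MeasurableEquiv.addRight a).measurableEmbedding (f := φ) (s := Ioi (c + a))
  rwa [shift_pre] at this

lemma tail_anti (P : Measure ℝ) [IsProbabilityMeasure P] : Antitone (fun t => P.real (Ioi t)) :=
  fun _ _ hst => measureReal_mono (Ioi_subset_Ioi hst)

lemma id_int_iff {P : Measure ℝ} [IsProbabilityMeasure P] (h0 : ∀ᵐ y ∂P, 0 ≤ y) :
    Integrable (fun x => x) P ↔ IntegrableOn (fun t => P.real (Ioi t)) (Ioi 0) := by
  have key := lintegral_eq_lintegral_meas_lt P (f := fun x => x) h0 aemeasurable_id'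
  have e1 : ∫⁻ t in Ioi 0, P {a | t < a} = ∫⁻ t in Ioi 0, ENNReal.ofReal (P.real (Ioi t)) := by
    congr 1; ext t; rw [ofReal_measureReal]; rfl
  rw [e1] at key
  have m2 : AEStronglyMeasurable (fun t => P.real (Ioi t)) (volume.restrict (Ioi 0)) :=
    (tail_anti P).measurable.aestronglyMeasurable
  have g1 := hasFiniteIntegral_iff_ofReal (f := fun x => x) h0
  have g2 := hasFiniteIntegral_iff_ofReal (μ := volume.restrict (Ioi 0))
    (f := fun t => P.real (Ioi t)) (Eventually.of_forall fun t => measureReal_nonneg)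
  rw [IntegrableOn, Integrable, Integrable, g1, g2, key]
  simp only [m2, true_and]
  exact ⟨fun h => h.2, fun h => ⟨measurable_id.aestronglyMeasurable, h⟩⟩

lemma g_eq_tail {P : Measure ℝ} [IsProbabilityMeasure P]
    (hi : Integrable (fun x => x) P) (s : ℝ) :
    (∫ y, max (y - s) 0 ∂P) = ∫ t in Ioi s, P.real (Ioi t) := by
  rw [(pos_int hi s).integral_eq_integral_meas_lt (Eventually.of_forall fun _ => le_max_right _ _)]
  have : ∀ t ∈ Ioi (0:ℝ), P.real {a | t < max (a - s) 0} = P.real (Ioi (t + s)) := by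
    intro t ht
    congr 1; ext a
    have : (0:ℝ) < t := ht
    simp only [mem_ofPred_eq, lt_max_iff, mem_Ioi]
    constructor
    · rintro (h | h) <;> linarith
    · intro h; left; linarith
  rw [setIntegral_congr_fun measurableSet_Ioi this]
  have := shift_int (fun t => P.real (Ioi t)) 0 s
  simpa using this

lemma tail_rc (P : Measure ℝ) [IsProbabilityMeasure P] (s : ℝ) :
    ContinuousWithinAt (fun t => P.real (Ioi t)) (Ici s) s := by
  have : (fun t => P.real (Ioi t)) = fun t => 1 - ProbabilityTheory.cdf P t := by
    ext t
    rw [ProbabilityTheory.cdf_eq_real, ← compl_Iic, probReal_compl_eq_one_sub measurableSet_Iic]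
  rw [this]
  exact continuousWithinAt_const.sub ((ProbabilityTheory.cdf P).right_continuous s)

lemma tail_eq (P : Measure ℝ) [IsProbabilityMeasure P] (s : ℝ) :
    (P (Iic s)).toReal - 1 = - P.real (Ioi s) := by
  rw [← compl_Iic, probReal_compl_eq_one_sub measurableSet_Iic, Measure.real]; ring

lemma g_ftc {P : Measure ℝ} [IsProbabilityMeasure P] (h0 : ∀ᵐ y ∂P, 0 ≤ y)
    (hi : Integrable (fun x => x) P) (s : ℝ) (hs : 0 ≤ s) :
    (∫ y, max (y - s) 0 ∂P) = (∫ y, max (y - 0) 0 ∂P) - ∫ t in (0:ℝ)..s, P.real (Ioi t) := by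
  have hI := (id_int_iff h0).1 hi
  rw [g_eq_tail hi, g_eq_tail hi]
  have := intervalIntegral.integral_interval_add_Ioi hI (hI.mono_set (Ioi_subset_Ioi hs))
  linarith

/-- the candidate tail function -/
noncomputable def tailF (a ν : ℝ) (P : Measure ℝ) (x : ℝ) : ℝ := ν * ∫ y, max (y - (x - a)) 0 ∂P

lemma tailF_ftc {P : Measure ℝ} [IsProbabilityMeasure P] (h0 : ∀ᵐ y ∂P, 0 ≤ y)
    (hi : Integrable (fun x => x) P) (a ν x : ℝ) (hx : a ≤ x) :
    tailF a ν P x = tailF a ν P a + ∫ t in a..x, - ν * P.real (Ioi (t - a)) := by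
  unfold tailF
  rw [g_ftc h0 hi (x - a) (by linarith), intervalIntegral.integral_const_mul,
    intervalIntegral.integral_comp_sub_right (fun t => P.real (Ioi t)) a]
  simp only [sub_self]
  ring

lemma D_int (P : Measure ℝ) [IsProbabilityMeasure P] (a ν : ℝ) (hν : 0 < ν) :
    Monotone (fun t => - ν * P.real (Ioi (t - a))) := by
  intro s t hst
  have : P.real (Ioi (t - a)) ≤ P.real (Ioi (s - a)) := tail_anti P (by linarith)
  simp only
  nlinarith

lemma D_rc (P : Measure ℝ) [IsProbabilityMeasure P] (a ν x : ℝ) :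
    ContinuousWithinAt (fun t => - ν * P.real (Ioi (t - a))) (Ici x) x := by
  apply continuousWithinAt_const.mul
  have h2 : ContinuousWithinAt (fun t : ℝ => t - a) (Ici x) x := by fun_prop
  have h3 : MapsTo (fun t : ℝ => t - a) (Ici x) (Ici (x - a)) :=
    fun t ht => by simp only [mem_Ici] at *; linarith
  have h4 := ContinuousWithinAt.comp (f := fun t : ℝ => t - a) (x := x)
    (g := fun t => P.real (Ioi t)) (tail_rc P (x - a)) h2 h3
  exact h4

lemma tailF_deriv {P : Measure ℝ} [IsProbabilityMeasure P] (h0 : ∀ᵐ y ∂P, 0 ≤ y)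
    (hi : Integrable (fun x => x) P) (a ν x : ℝ) (hν : 0 < ν) (hx : a ≤ x) :
    HasDerivWithinAt (tailF a ν P) (- ν * P.real (Ioi (x - a))) (Ici x) x := by
  have hm := D_int P a ν hν
  have h1 : HasDerivWithinAt (fun u => ∫ t in a..u, - ν * P.real (Ioi (t - a)))
      (- ν * P.real (Ioi (x - a))) (Ici x) x :=
    intervalIntegral.integral_hasDerivWithinAt_right (t := Ioi x) hm.intervalIntegrable
      hm.measurable.stronglyMeasurable.stronglyMeasurableAtFilter
      ((D_rc P a ν x).mono Ioi_subset_Ici_self)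
  have h2 := h1.const_add (tailF a ν P a)
  exact h2.congr (fun y hy => tailF_ftc h0 hi a ν y (hx.trans hy)) (tailF_ftc h0 hi a ν x hx)

lemma tailF_convex {P : Measure ℝ} [IsProbabilityMeasure P]
    (hi : Integrable (fun x => x) P) (a ν : ℝ) (hν : 0 < ν) (s : Set ℝ) (hs : Convex ℝ s) :
    ConvexOn ℝ s (tailF a ν P) := by
  refine ⟨hs, fun x _ y _ α β hα hβ hαβ => ?_⟩
  unfold tailF
  have h1 : (∫ z, max (z - ((α • x + β • y) - a)) 0 ∂P) ≤
      ∫ z, (α * max (z - (x - a)) 0 + β * max (z - (y - a)) 0) ∂P := by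
    apply integral_mono (pos_int hi _)
      (((pos_int hi _).const_mul _).add ((pos_int hi _).const_mul _))
    intro z
    simp only [smul_eq_mul, Pi.add_apply]
    have e1 := mul_le_mul_of_nonneg_left (le_max_left (z - (x - a)) 0) hα
    have e2 := mul_le_mul_of_nonneg_left (le_max_left (z - (y - a)) 0) hβ
    have e3 := mul_nonneg hα (le_max_right (z - (x - a)) 0)
    have e4 := mul_nonneg hβ (le_max_right (z - (y - a)) 0)
    apply max_le
    · have : z - (α * x + β * y - a) = α * (z - (x - a)) + β * (z - (y - a)) := by
        have : β = 1 - α := by linarith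
        subst this; ring
      linarith
    · linarith
  rw [integral_add ((pos_int hi _).const_mul _) ((pos_int hi _).const_mul _),
    integral_const_mul, integral_const_mul] at h1
  have := mul_le_mul_of_nonneg_left h1 hν.le
  simp only [smul_eq_mul] at *
  linarith

lemma tailF_at {P : Measure ℝ} [IsProbabilityMeasure P] (h0 : ∀ᵐ y ∂P, 0 ≤ y) (a ν : ℝ) :
    tailF a ν P a = ν * ∫ y, y ∂P := by
  unfold tailF
  congr 1
  apply integral_congr_ae
  filter_upwards [h0] with y hy
  simp [hy]

lemma core_int {P : Measure ℝ} [IsProbabilityMeasure P] (h0 : ∀ᵐ y ∂P, 0 ≤ y)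
    (hi : Integrable (fun x => x) P) (a ν : ℝ) (hν : 0 < ν) :
    IntegrableOn (tailF a ν P) (Ioi a) ↔ Integrable (fun y => y ^ 2) P := by
  rw [(prod_int h0 hi).2]
  have := shift_intOn (tailF a ν P) 0 a
  rw [zero_add] at this
  rw [← this]
  unfold tailF
  simp only [add_sub_cancel_right]
  exact integrable_const_mul_iff hν.ne'.isUnit _

lemma core_obj {P : Measure ℝ} [IsProbabilityMeasure P] (h0 : ∀ᵐ y ∂P, 0 ≤ y)
    (hi : Integrable (fun x => x) P) (hi2 : Integrable (fun y => y ^ 2) P) (a ν : ℝ)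
    (h : ℝ → ℝ) (hmeas : Measurable h) (hbd : ∃ M, ∀ x, |h x| ≤ M) :
    ν * ∫ x, Hfun a h x ∂P = ∫ x in Ioi a, h x * tailF a ν P x := by
  obtain ⟨M, hM⟩ := hbd
  have := shift_int (fun x => h x * tailF a ν P x) 0 a
  rw [zero_add] at this
  rw [← this]
  have e := fub h0 hi hi2 (fun v => h (v + a)) (hmeas.comp (measurable_add_const a)) M
    (fun x => hM _)
  unfold Hfun
  rw [← e, ← integral_const_mul]
  congr 1; ext t
  unfold tailF
  rw [add_sub_cancel_right]; ring

lemma core_mass {P : Measure ℝ} [IsProbabilityMeasure P] (h0 : ∀ᵐ y ∂P, 0 ≤ y)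
    (hi : Integrable (fun x => x) P) (hi2 : Integrable (fun y => y ^ 2) P) (a ν : ℝ) :
    (∫ x in Ioi a, tailF a ν P x) = ν * ((∫ y, y ^ 2 ∂P) / 2) := by
  have := shift_int (tailF a ν P) 0 a
  rw [zero_add] at this
  rw [← this, ← fub_one h0 hi hi2, ← integral_const_mul]
  congr 1; ext t
  unfold tailF
  rw [add_sub_cancel_right]

lemma rd_eq {f : ℝ → ℝ} {x d : ℝ} (h : HasDerivWithinAt f d (Ioi x) x) : rightDeriv f x = d :=
  h.derivWithin (uniqueDiffWithinAt_Ioi x)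

lemma ae_nonneg {P : Measure ℝ} (h : P (Iio 0) = 0) : ∀ᵐ y ∂P, 0 ≤ y := by
  rw [ae_iff]; convert h using 2; ext y; simp

lemma tailF_feasible (a βl βu ηl ηu ν : ℝ) (hν : 0 < ν) (P : Measure ℝ)
    (hP : RMomFeasible (ηl / ν) (ηu / ν) (2 * βl / ν) (2 * βu / ν) P) :
    RFeasible a βl βu ηl ηu ν (tailF a ν P) := by
  obtain ⟨hp, hz, hi, hi2, m1, m2, s1, s2⟩ := hP
  have h0 := ae_nonneg hz
  have hd := tailF_deriv h0 hi a ν a hν le_rfl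
  rw [div_le_iff₀ hν] at m1 s1
  rw [le_div_iff₀ hν] at m2 s2
  refine ⟨(core_int h0 hi a ν hν).2 hi2, ?_, ?_, ?_, ?_, hd.continuousWithinAt,
    ⟨_, hd.mono Ioi_subset_Ici_self⟩, ?_, tailF_convex hi a ν hν _ (convex_Ici a), ?_⟩
  · rw [core_mass h0 hi hi2]; linarith
  · rw [core_mass h0 hi hi2]; linarith
  · rw [tailF_at h0]; linarith
  · rw [tailF_at h0]; linarith
  · rw [rd_eq (hd.mono Ioi_subset_Ici_self)]
    have : P.real (Ioi (a - a)) ≤ 1 := measureReal_le_one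
    nlinarith
  · intro x _
    exact mul_nonneg hν.le (integral_nonneg fun y => le_max_right _ _)

section Feas
variable {a βl βu ηl ηu ν : ℝ} {f : ℝ → ℝ}

lemma feas_deriv (hf : RFeasible a βl βu ηl ηu ν f) {x : ℝ} (hx : a ≤ x) :
    HasDerivWithinAt f (rightDeriv f x) (Ioi x) x := by
  obtain ⟨-, -, -, -, -, -, ⟨d, hd⟩, -, hc, -⟩ := hf
  rcases hx.eq_or_lt with rfl | hx
  · rwa [rd_eq hd]
  · exact hc.hasDerivWithinAt_rightDeriv_of_mem_interior (by simpa using hx)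

lemma feas_convex (hf : RFeasible a βl βu ηl ηu ν f) : ConvexOn ℝ (Ici a) f := hf.2.2.2.2.2.2.2.2.1

lemma feas_nonneg (hf : RFeasible a βl βu ηl ηu ν f) {x : ℝ} (hx : a ≤ x) : 0 ≤ f x :=
  hf.2.2.2.2.2.2.2.2.2 x hx

lemma feas_le_slope (hf : RFeasible a βl βu ηl ηu ν f) {x y : ℝ} (hx : a ≤ x) (hxy : x < y) :
    rightDeriv f x ≤ slope f x y :=
  (feas_convex hf).le_slope_of_hasDerivWithinAt_Ioi hx (hx.trans hxy.le) hxy (feas_deriv hf hx)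

lemma feas_slope_le (hf : RFeasible a βl βu ηl ηu ν f) {x y : ℝ} (hx : a ≤ x) (hxy : x < y) :
    slope f x y ≤ rightDeriv f y := by
  have hy : y ∈ interior (Ici a) := by simpa using hx.trans_lt hxy
  exact ((feas_convex hf).slope_le_leftDeriv_of_mem_interior hx hy hxy).trans
    ((feas_convex hf).leftDeriv_le_rightDeriv_of_mem_interior hy)

lemma feas_mono (hf : RFeasible a βl βu ηl ηu ν f) {x y : ℝ} (hx : a ≤ x) (hxy : x ≤ y) :
    rightDeriv f x ≤ rightDeriv f y := by
  rcases hxy.eq_or_lt with rfl | hxy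
  · exact le_rfl
  · exact (feas_le_slope hf hx hxy).trans (feas_slope_le hf hx hxy)

lemma feas_cont (hf : RFeasible a βl βu ηl ηu ν f) : ContinuousOn f (Ici a) := by
  intro x hx
  rcases (mem_Ici.1 hx).eq_or_lt with rfl | hx
  · exact hf.2.2.2.2.2.1
  · have h1 := (feas_convex hf).continuousOn_interior x (by simpa using hx)
    rw [interior_Ici] at h1
    exact (h1.continuousAt (Ioi_mem_nhds hx)).continuousWithinAt

lemma feas_nonpos (hf : RFeasible a βl βu ηl ηu ν f) {x : ℝ} (hx : a ≤ x) :
    rightDeriv f x ≤ 0 := by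
  by_contra! hc
  have hI : IntegrableOn f (Ioi (x + 1)) := hf.1.mono_set (Ioi_subset_Ioi (by linarith))
  have hk : IntegrableOn (fun _ : ℝ => rightDeriv f x) (Ioi (x + 1)) := by
    refine Integrable.mono' hI aestronglyMeasurable_const ?_
    refine (ae_restrict_iff' measurableSet_Ioi).2 (Eventually.of_forall fun y hy => ?_)
    have hy : x + 1 < y := hy
    rw [Real.norm_of_nonneg hc.le]
    have h1 := feas_le_slope hf hx (show x < y by linarith)
    rw [slope_def_field, le_div_iff₀ (by linarith)] at h1
    have := feas_nonneg hf hx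
    nlinarith
  rw [integrableOn_const_iff] at hk
  simp [hc.ne'] at hk

lemma feas_anti (hf : RFeasible a βl βu ηl ηu ν f) {x y : ℝ} (hx : a ≤ x) (hxy : x ≤ y) :
    f y ≤ f x := by
  rcases hxy.eq_or_lt with rfl | hxy
  · exact le_rfl
  · have h1 := (feas_slope_le hf hx hxy).trans (feas_nonpos hf (hx.trans hxy.le))
    rw [slope_def_field, div_le_iff₀ (by linarith)] at h1
    linarith

lemma inv_tendsto (a B : ℝ) : Tendsto (fun x => B / (x - a)) atTop (𝓝 0) :=
  Tendsto.div_atTop tendsto_const_nhds (tendsto_atTop_add_const_right _ (-a) tendsto_id)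

lemma feas_tendsto (hf : RFeasible a βl βu ηl ηu ν f) : Tendsto f atTop (𝓝 0) := by
  refine tendsto_of_tendsto_of_tendsto_of_le_of_le' tendsto_const_nhds
    (inv_tendsto a (∫ x in Ioi a, f x)) ?_ ?_
  · filter_upwards [eventually_ge_atTop a] with x hx using feas_nonneg hf hx
  · filter_upwards [eventually_gt_atTop a] with x hx
    rw [le_div_iff₀ (by linarith)]
    have h1 : (∫ _ in Ioc a x, f x) ≤ ∫ t in Ioc a x, f t := by
      apply setIntegral_mono_on (by simp) (hf.1.mono_set Ioc_subset_Ioi_self) measurableSet_Ioc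
      intro t ht
      exact feas_anti hf ht.1.le ht.2
    have h2 : (∫ t in Ioc a x, f t) ≤ ∫ t in Ioi a, f t := by
      apply setIntegral_mono_set hf.1 _ Ioc_subset_Ioi_self.eventuallyLE
      exact (ae_restrict_iff' measurableSet_Ioi).2 (Eventually.of_forall fun y hy =>
        feas_nonneg hf (le_of_lt hy))
    simp [Measure.real, hx.le] at h1
    linarith

lemma feas_rd_tendsto (hf : RFeasible a βl βu ηl ηu ν f) :
    Tendsto (rightDeriv f) atTop (𝓝 0) := by
  refine tendsto_of_tendsto_of_tendsto_of_le_of_le' (inv_tendsto a (- f a))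
    tendsto_const_nhds ?_ ?_
  · filter_upwards [eventually_gt_atTop a] with x hx
    refine le_trans ?_ (feas_slope_le hf le_rfl hx)
    rw [slope_def_field]
    have := feas_nonneg hf hx.le
    exact div_le_div_of_nonneg_right (by linarith) (by linarith)
  · filter_upwards [eventually_ge_atTop a] with x hx using feas_nonpos hf hx

lemma feas_rc (hf : RFeasible a βl βu ηl ηu ν f) {x : ℝ} (hx : a ≤ x) :
    ContinuousWithinAt (rightDeriv f) (Ici x) x := by
  refine tendsto_order.2 ⟨fun l hl => ?_, fun u hu => ?_⟩
  · filter_upwards [self_mem_nhdsWithin] with z hz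
    exact hl.trans_le (feas_mono hf hx hz)
  · have h1 := (hasDerivWithinAt_iff_tendsto_slope' self_notMem_Ioi).mp (feas_deriv hf hx)
    obtain ⟨y, hy, hxy⟩ := ((h1.eventually (gt_mem_nhds hu)).and self_mem_nhdsWithin).exists
    have hxy : x < y := hxy
    have h2 : ContinuousWithinAt (fun z => slope f z y) (Ici x) x := by
      simp only [slope_def_field]
      have hc : ContinuousWithinAt f (Ici x) x := (feas_cont hf x hx).mono (Ici_subset_Ici.2 hx)
      exact (continuousWithinAt_const.sub hc).div (by fun_prop) (by linarith)
    filter_upwards [h2.eventually (gt_mem_nhds hy), self_mem_nhdsWithin,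
      mem_nhdsWithin_of_mem_nhds (Iio_mem_nhds hxy)] with z h3 h4 h5
    exact (feas_le_slope hf (hx.trans h4) h5).trans_lt h3

lemma feas_rep (hν : 0 < ν) (hf : RFeasible a βl βu ηl ηu ν f) {P : Measure ℝ}
    [IsProbabilityMeasure P] (h0 : ∀ᵐ y ∂P, 0 ≤ y)
    (hr : ∀ x, 0 ≤ x → rightDeriv f (x + a) = ν * ((P (Set.Iic x)).toReal - 1)) :
    Integrable (fun x => x) P ∧ ∀ x, a ≤ x → f x = tailF a ν P x := by
  have hD : ∀ x, a ≤ x → rightDeriv f x = - ν * P.real (Ioi (x - a)) := by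
    intro x hx
    have := hr (x - a) (by linarith)
    rw [sub_add_cancel, tail_eq] at this
    rw [this]; ring
  have hT : ∀ s b, 0 ≤ s → s ≤ b →
      (∫ t in s..b, P.real (Ioi t)) = (f (s + a) - f (b + a)) / ν := by
    intro s b hs hb
    have h1 : ∫ t in (s + a)..(b + a), - ν * P.real (Ioi (t - a)) = f (b + a) - f (s + a) := by
      apply intervalIntegral.integral_eq_sub_of_hasDeriv_right_of_le (by linarith)
      · exact (feas_cont hf).mono fun z hz => by
          have := hz.1
          simp only [mem_Ici]; linarith
      · intro z hz
        have hz1 : a ≤ z := by have := hz.1; linarith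
        rw [← hD z hz1]
        exact feas_deriv hf hz1
      · exact (D_int P a ν hν).intervalIntegrable
    rw [intervalIntegral.integral_const_mul,
      intervalIntegral.integral_comp_sub_right (fun t => P.real (Ioi t)) a] at h1
    simp only [add_sub_cancel_right] at h1
    rw [eq_div_iff hν.ne']
    linarith
  have hI : IntegrableOn (fun t => P.real (Ioi t)) (Ioi 0) := by
    refine integrableOn_Ioi_of_intervalIntegral_norm_bounded (b := fun x : ℝ => x) (l := atTop)
      (f a / ν) 0 (fun i => ?_) tendsto_id ?_
    · exact ((tail_anti P).antitoneOn (Icc 0 i)).integrableOn_isCompact isCompact_Icc |>.mono_set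
        Ioc_subset_Icc_self
    · filter_upwards [eventually_ge_atTop 0] with b hb
      simp only [Real.norm_of_nonneg measureReal_nonneg]
      rw [hT 0 b le_rfl hb, zero_add]
      have := feas_nonneg hf (show a ≤ b + a by linarith)
      exact div_le_div_of_nonneg_right (by linarith) hν.le
  have hi := (id_int_iff h0).2 hI
  refine ⟨hi, fun x hx => ?_⟩
  unfold tailF
  rw [g_eq_tail hi]
  have h1 := intervalIntegral_tendsto_integral_Ioi (b := fun x : ℝ => x) (l := atTop) (x - a)
    (hI.mono_set (Ioi_subset_Ioi (by linarith))) tendsto_id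
  have h2 : Tendsto (fun b => ∫ t in (x - a)..b, P.real (Ioi t)) atTop (𝓝 ((f x - 0) / ν)) := by
    have h3 : Tendsto (fun b => (f x - f (b + a)) / ν) atTop (𝓝 ((f x - 0) / ν)) :=
      (tendsto_const_nhds.sub ((feas_tendsto hf).comp
        (tendsto_atTop_add_const_right _ a tendsto_id))).div_const ν
    refine h3.congr' ?_
    filter_upwards [eventually_ge_atTop (x - a)] with b hb
    rw [hT (x - a) b (by linarith) hb, sub_add_cancel]
  rw [tendsto_nhds_unique h1 h2, sub_zero]
  field_simp

lemma feas_measure (hν : 0 < ν) (hf : RFeasible a βl βu ηl ηu ν f) :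
    ∃ P : Measure ℝ, IsProbabilityMeasure P ∧ P (Iio 0) = 0 ∧
      ∀ x, 0 ≤ x → rightDeriv f (x + a) = ν * ((P (Set.Iic x)).toReal - 1) := by
  have hlow : ∀ x, 0 ≤ x → 0 ≤ 1 + rightDeriv f (x + a) / ν := by
    intro x hx
    have h1 : -ν ≤ rightDeriv f a := hf.2.2.2.2.2.2.2.1
    have h2 := feas_mono hf le_rfl (show a ≤ x + a by linarith)
    have : -1 ≤ rightDeriv f (x + a) / ν := by
      rw [le_div_iff₀ hν]; linarith
    linarith
  let F : StieltjesFunction ℝ :=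
    { toFun := fun x => if 0 ≤ x then 1 + rightDeriv f (x + a) / ν else 0
      mono' := by
        intro x y hxy
        simp only
        split_ifs with h1 h2 h2
        · have := feas_mono hf (show a ≤ x + a by linarith) (show x + a ≤ y + a by linarith)
          have := div_le_div_of_nonneg_right this hν.le
          linarith
        · exact absurd (h1.trans hxy) h2
        · exact hlow y h2
        · exact le_rfl
      right_continuous' := by
        intro x
        rcases le_or_gt 0 x with hx | hx
        · have h1 : ContinuousWithinAt (fun x => 1 + rightDeriv f (x + a) / ν) (Ici x) x := by
            have h3 : MapsTo (fun t : ℝ => t + a) (Ici x) (Ici (x + a)) :=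
              fun t ht => by simp only [mem_Ici] at *; linarith
            have h2 : ContinuousWithinAt (fun t : ℝ => t + a) (Ici x) x := by fun_prop
            have h4 := ContinuousWithinAt.comp (f := fun t : ℝ => t + a) (x := x)
              (g := rightDeriv f) (feas_rc hf (show a ≤ x + a by linarith)) h2 h3
            exact continuousWithinAt_const.add (h4.div_const ν)
          refine h1.congr (fun y hy => ?_) ?_
          · rw [if_pos (hx.trans hy)]
          · rw [if_pos hx]
        · refine ContinuousAt.continuousWithinAt ?_
          refine (continuousAt_const (y := (0:ℝ))).congr ?_
          filter_upwards [Iio_mem_nhds hx] with y hy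
          rw [if_neg (not_le.2 hy)] }
  have Fdef : ∀ x, F x = if 0 ≤ x then 1 + rightDeriv f (x + a) / ν else 0 := fun _ => rfl
  have hbot : Tendsto F atBot (𝓝 0) := by
    refine tendsto_const_nhds.congr' ?_
    filter_upwards [eventually_lt_atBot 0] with x hx
    rw [Fdef, if_neg (not_le.2 hx)]
  have htop : Tendsto F atTop (𝓝 1) := by
    have h1 : Tendsto (fun x => 1 + rightDeriv f (x + a) / ν) atTop (𝓝 (1 + 0 / ν)) :=
      tendsto_const_nhds.add (((feas_rd_tendsto hf).comp
        (tendsto_atTop_add_const_right _ a tendsto_id)).div_const ν)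
    rw [zero_div, add_zero] at h1
    refine h1.congr' ?_
    filter_upwards [eventually_ge_atTop 0] with x hx
    rw [Fdef, if_pos hx]
  refine ⟨F.measure, F.isProbabilityMeasure hbot htop, ?_, fun x hx => ?_⟩
  · rw [F.measure_Iio hbot]
    have : Function.leftLim F 0 = 0 := by
      apply leftLim_eq_of_tendsto
      refine tendsto_const_nhds.congr' ?_
      filter_upwards [self_mem_nhdsWithin] with x hx
      rw [Fdef, if_neg (not_le.2 hx)]
    simp [this]
  · rw [F.measure_Iic hbot, Fdef, if_pos hx, sub_zero, ENNReal.toReal_ofReal (hlow x hx)]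
    field_simp
    ring

end Feas

lemma part_two (a βl βu ηl ηu ν : ℝ) (hν : 0 < ν)
    (h : ℝ → ℝ) (hmeas : Measurable h) (hbd : ∃ M, ∀ x, |h x| ≤ M)
    (f : ℝ → ℝ) (hf : RFeasible a βl βu ηl ηu ν f) :
    ∃ P : Measure ℝ, RMomFeasible (ηl / ν) (ηu / ν) (2 * βl / ν) (2 * βu / ν) P ∧
        (∀ x, 0 ≤ x → rightDeriv f (x + a) = ν * ((P (Set.Iic x)).toReal - 1)) ∧
        ν * ∫ x, Hfun a h x ∂P = ∫ x in Set.Ioi a, h x * f x := by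
  obtain ⟨P, hp, hz, hr⟩ := feas_measure hν hf
  have h0 := ae_nonneg hz
  obtain ⟨hi, he⟩ := feas_rep hν hf h0 hr
  have hon : EqOn f (tailF a ν P) (Ioi a) := fun x hx => he x (le_of_lt hx)
  have hi2 : Integrable (fun y => y ^ 2) P :=
    (core_int h0 hi a ν hν).1 (hf.1.congr_fun hon measurableSet_Ioi)
  have hm := core_mass h0 hi hi2 a ν
  rw [← setIntegral_congr_fun measurableSet_Ioi hon] at hm
  have ha := (he a le_rfl).trans (tailF_at h0 a ν)
  obtain ⟨-, b1, b2, e1, e2, -⟩ := hf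
  refine ⟨P, ⟨hp, hz, hi, hi2, ?_, ?_, ?_, ?_⟩, hr, ?_⟩
  · rw [div_le_iff₀ hν]; linarith
  · rw [le_div_iff₀ hν]; linarith
  · rw [div_le_iff₀ hν]; linarith
  · rw [le_div_iff₀ hν]; linarith
  · rw [core_obj h0 hi hi2 a ν h hmeas hbd]
    apply setIntegral_congr_fun measurableSet_Ioi
    intro x hx
    simp only [hon hx]

lemma part_three (a βl βu ηl ηu ν : ℝ) (hν : 0 < ν)
    (h : ℝ → ℝ) (hmeas : Measurable h) (hbd : ∃ M, ∀ x, |h x| ≤ M)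
    (P : Measure ℝ) (hP : RMomFeasible (ηl / ν) (ηu / ν) (2 * βl / ν) (2 * βu / ν) P) :
    ∃ f : ℝ → ℝ, (RFeasible a βl βu ηl ηu ν f ∧
          (∀ x, 0 ≤ x → rightDeriv f (x + a) = ν * ((P (Set.Iic x)).toReal - 1)) ∧
          (∀ x, a ≤ x → f x = f a + ∫ t in a..x, rightDeriv f t) ∧
          ν * ∫ x, Hfun a h x ∂P = ∫ x in Set.Ioi a, h x * f x) ∧
        (∀ g : ℝ → ℝ, (RFeasible a βl βu ηl ηu ν g ∧
            (∀ x, 0 ≤ x → rightDeriv g (x + a) = ν * ((P (Set.Iic x)).toReal - 1)) ∧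
            (∀ x, a ≤ x → g x = g a + ∫ t in a..x, rightDeriv g t)) →
          ∀ x, a ≤ x → g x = f x) := by
  have hF := tailF_feasible a βl βu ηl ηu ν hν P hP
  obtain ⟨hp, hz, hi, hi2, -⟩ := hP
  have h0 := ae_nonneg hz
  have hrd : ∀ x, a ≤ x → rightDeriv (tailF a ν P) x = - ν * P.real (Ioi (x - a)) :=
    fun x hx => rd_eq ((tailF_deriv h0 hi a ν x hν hx).mono Ioi_subset_Ici_self)
  refine ⟨tailF a ν P, ⟨hF, fun x hx => ?_, fun x hx => ?_, core_obj h0 hi hi2 a ν h hmeas hbd⟩,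
    fun g hg => (feas_rep hν hg.1 h0 hg.2.1).2⟩
  · rw [hrd _ (by linarith), tail_eq, add_sub_cancel_right]; ring
  · rw [tailF_ftc h0 hi a ν x hx]
    congr 1
    apply intervalIntegral.integral_congr
    intro t ht
    rw [uIcc_of_le hx] at ht
    exact (hrd t ht.1).symm

/-- Theorem: the relaxed worst-case tail problem has the same optimal value as
`ÕPT(𝒫⁺)`, with a one-to-one correspondence between feasible solutions given via the
cdf relation `f′₊(x + a) = ν̄(p(x) − 1)`; corresponding solutions have equal objective
values. -/
theorem relaxed_eq_moment_problem
    (a βl βu ηl ηu ν : ℝ)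
    (hβl : 0 < βl) (hβ : βl ≤ βu) (hηl : 0 < ηl) (hη : ηl ≤ ηu) (hν : 0 < ν)
    (h : ℝ → ℝ) (hmeas : Measurable h) (hbd : ∃ M, ∀ x, |h x| ≤ M)
    (μl μu σl σu : ℝ)
    (hμl : μl = ηl / ν) (hμu : μu = ηu / ν) (hσl : σl = 2 * βl / ν) (hσu : σu = 2 * βu / ν) :
    (sSup {z : ℝ | ∃ f : ℝ → ℝ, RFeasible a βl βu ηl ηu ν f ∧
        z = ∫ x in Set.Ioi a, h x * f x} =
      sSup {z : ℝ | ∃ P : Measure ℝ, RMomFeasible μl μu σl σu P ∧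
        z = ν * ∫ x, Hfun a h x ∂P}) ∧
    (∀ f : ℝ → ℝ, RFeasible a βl βu ηl ηu ν f →
      ∃ P : Measure ℝ, RMomFeasible μl μu σl σu P ∧
        (∀ x, 0 ≤ x → rightDeriv f (x + a) = ν * ((P (Set.Iic x)).toReal - 1)) ∧
        ν * ∫ x, Hfun a h x ∂P = ∫ x in Set.Ioi a, h x * f x) ∧
    (∀ P : Measure ℝ, RMomFeasible μl μu σl σu P →
      ∃ f : ℝ → ℝ, (RFeasible a βl βu ηl ηu ν f ∧
          (∀ x, 0 ≤ x → rightDeriv f (x + a) = ν * ((P (Set.Iic x)).toReal - 1)) ∧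
          (∀ x, a ≤ x → f x = f a + ∫ t in a..x, rightDeriv f t) ∧
          ν * ∫ x, Hfun a h x ∂P = ∫ x in Set.Ioi a, h x * f x) ∧
        (∀ g : ℝ → ℝ, (RFeasible a βl βu ηl ηu ν g ∧
            (∀ x, 0 ≤ x → rightDeriv g (x + a) = ν * ((P (Set.Iic x)).toReal - 1)) ∧
            (∀ x, a ≤ x → g x = g a + ∫ t in a..x, rightDeriv g t)) →
          ∀ x, a ≤ x → g x = f x)) := by
  subst hμl hμu hσl hσu
  have h2 := part_two a βl βu ηl ηu ν hν h hmeas hbd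
  have h3 := part_three a βl βu ηl ηu ν hν h hmeas hbd
  refine ⟨?_, h2, h3⟩
  congr 1
  ext z
  constructor
  · rintro ⟨f, hf, rfl⟩
    obtain ⟨P, hP, -, he⟩ := h2 f hf
    exact ⟨P, hP, he.symm⟩
  · rintro ⟨P, hP, rfl⟩
    obtain ⟨f, ⟨hf, -, -, he⟩, -⟩ := h3 P hP
    exact ⟨f, hf, he⟩
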